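/- arXiv:1610.01549 — 2 statements merged into one kernel-verified Lean document; each statement's English description precedes it below -/
import Mathlib

section
/- Let E₀, E₁, E₂, E₃ and H be finite-dimensional real inner product spaces, let α : E₀ → E₁ be continuously differentiable, f : E₁ × H → E₂ be twice continuously differentiable (jointly), and ω : E₂ → E₃ be twice continuously differentiable. Define F(x; θ) = ω(f(α(x); θ)) and set x₁ = α(x), x₂ = f(x₁; θ). Then for every v ∈ E₀, (∇_θ D_x F(x; θ) ⌟ v)* = ∇*_θ f(x₁; θ) ∘ ((D_x f(x₁; θ)·(Dα(x)·v)) ⌟ D²ω(x₂))* + ((Dα(x)·v) ⌟ D_x ∇_θ f(x₁; θ))* ∘ D*ω(x₂), as an identity of linear maps from E₃ to H. -/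
section PartialDerivatives

variable {E G V : Type*} [NormedAddCommGroup E] [NormedSpace ℝ E]
  [NormedAddCommGroup G] [NormedSpace ℝ G] [NormedAddCommGroup V] [NormedSpace ℝ V]

theorem HasFDerivAt.partial_fst {g : E × G → V} {g' : E × G →L[ℝ] V} {x : E} {y : G}
    (hg : HasFDerivAt g g' (x, y)) :
    HasFDerivAt (fun x' => g (x', y)) (g'.comp (ContinuousLinearMap.inl ℝ E G)) x :=
  hg.comp x (hasFDerivAt_prodMk_left x y)

theorem HasFDerivAt.partial_snd {g : E × G → V} {g' : E × G →L[ℝ] V} {x : E} {y : G}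
    (hg : HasFDerivAt g g' (x, y)) :
    HasFDerivAt (fun y' => g (x, y')) (g'.comp (ContinuousLinearMap.inr ℝ E G)) y :=
  hg.comp y (hasFDerivAt_prodMk_right x y)

/-- The mixed partial derivatives of a `C²` function of two variables agree with its second
derivative. -/
theorem fderiv_partial_fst_partial_snd_apply {g : E × G → V} (hg : ContDiff ℝ 2 g)
    (x : E) (y : G) (u : E) (w : G) :
    fderiv ℝ (fun x' => fderiv ℝ (fun y' => g (x', y')) y) x u w =
      fderiv ℝ (fderiv ℝ g) (x, y) (u, 0) (0, w) := by
  have hg1 : Differentiable ℝ g := hg.differentiable (by norm_num)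
  have hg2 : Differentiable ℝ (fderiv ℝ g) :=
    (hg.fderiv_right (m := 1) (by norm_num)).differentiable (by norm_num)
  have key : (fun x' => fderiv ℝ (fun y' => g (x', y')) y) =
      fun x' => (fderiv ℝ g (x', y)).comp (ContinuousLinearMap.inr ℝ E G) :=
    funext fun x' => (hg1 (x', y)).hasFDerivAt.partial_snd.fderiv
  rw [key, ((hg2 (x, y)).hasFDerivAt.partial_fst.clm_comp
    (hasFDerivAt_const (ContinuousLinearMap.inr ℝ E G) x)).fderiv]
  simp

end PartialDerivatives

/-- Let `α : E₀ → E₁` be `C¹`, `f : E₁ × H → E₂` jointly `C²`, and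
`ω : E₂ → E₃` be `C²`.  Define `F(x; θ) = ω (f (α x) θ)`, `x₁ = α x`, `x₂ = f x₁ θ`.  Then for
every `v : E₀`,
`(∇_θ D_x F(x; θ) ⌟ v)* = ∇*_θ f(x₁; θ) ∘ ((D_x f(x₁; θ)·(Dα(x)·v)) ⌟ D²ω(x₂))*
  + ((Dα(x)·v) ⌟ D_x ∇_θ f(x₁; θ))* ∘ D*ω(x₂)`,
as an identity of linear maps `E₃ → H`. -/
theorem statement10 {E₀ E₁ E₂ E₃ H : Type*}
    [NormedAddCommGroup E₀] [InnerProductSpace ℝ E₀] [FiniteDimensional ℝ E₀]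
    [NormedAddCommGroup E₁] [InnerProductSpace ℝ E₁] [FiniteDimensional ℝ E₁]
    [NormedAddCommGroup E₂] [InnerProductSpace ℝ E₂] [FiniteDimensional ℝ E₂]
    [NormedAddCommGroup E₃] [InnerProductSpace ℝ E₃] [FiniteDimensional ℝ E₃]
    [NormedAddCommGroup H] [InnerProductSpace ℝ H] [FiniteDimensional ℝ H]
    (α : E₀ → E₁) (f : E₁ → H → E₂) (ω : E₂ → E₃)
    (hα : ContDiff ℝ 1 α) (hf : ContDiff ℝ 2 (fun p : E₁ × H => f p.1 p.2))
    (hω : ContDiff ℝ 2 ω)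
    (F : E₀ → H → E₃) (hF : ∀ x' θ', F x' θ' = ω (f (α x') θ'))
    (x : E₀) (θ : H) (x₁ : E₁) (hx₁ : x₁ = α x) (x₂ : E₂) (hx₂ : x₂ = f x₁ θ) :
    ∀ v : E₀,
      ContinuousLinearMap.adjoint
          (fderiv ℝ (fun θ' => fderiv ℝ (fun x' => F x' θ') x v) θ) =
        (ContinuousLinearMap.adjoint (fderiv ℝ (f x₁) θ)).comp
            (ContinuousLinearMap.adjoint
              (fderiv ℝ (fderiv ℝ ω) x₂
                (fderiv ℝ (fun x' => f x' θ) x₁ (fderiv ℝ α x v)))) +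
          (ContinuousLinearMap.adjoint
              (fderiv ℝ (fun x' => fderiv ℝ (f x') θ) x₁ (fderiv ℝ α x v))).comp
            (ContinuousLinearMap.adjoint (fderiv ℝ ω x₂)) := by
  intro v
  subst hx₁ hx₂
  set g : E₁ × H → E₂ := fun p => f p.1 p.2
  set u := fderiv ℝ α x v with hu
  have hg1 : Differentiable ℝ g := hf.differentiable (by norm_num)
  have hg2 : Differentiable ℝ (fderiv ℝ g) :=
    (hf.fderiv_right (m := 1) (by norm_num)).differentiable (by norm_num)
  have hω1 : Differentiable ℝ ω := hω.differentiable (by norm_num)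
  have hω2 : Differentiable ℝ (fderiv ℝ ω) :=
    (hω.fderiv_right (m := 1) (by norm_num)).differentiable (by norm_num)
  have hα1 : DifferentiableAt ℝ α x := hα.differentiable (by norm_num) x
  have hfst (θ' : H) : HasFDerivAt (fun x' => f x' θ')
      ((fderiv ℝ g (α x, θ')).comp (ContinuousLinearMap.inl ℝ E₁ H)) (α x) :=
    (hg1 (α x, θ')).hasFDerivAt.partial_fst
  have hsnd : HasFDerivAt (f (α x))
      ((fderiv ℝ g (α x, θ)).comp (ContinuousLinearMap.inr ℝ E₁ H)) θ :=
    (hg1 (α x, θ)).hasFDerivAt.partial_snd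
  have hDF : (fun θ' => fderiv ℝ (fun x' => F x' θ') x v) =
      fun θ' => fderiv ℝ ω (f (α x) θ') (fderiv ℝ g (α x, θ') (u, 0)) := by
    funext θ'
    have h := (hω1 (f (α x) θ')).hasFDerivAt.comp x ((hfst θ').comp x hα1.hasFDerivAt)
    simp only [hF]
    rw [show (fun x' => ω (f (α x') θ')) = ω ∘ ((fun x' => f x' θ') ∘ α) from rfl, h.fderiv]
    simp [hu]
  have hsymm : IsSymmSndFDerivAt ℝ g (α x, θ) :=
    hf.contDiffAt.isSymmSndFDerivAt (by simp)
  have hmixed := fderiv_partial_fst_partial_snd_apply hf (α x) θ u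
  have hderiv := ((hω2 (f (α x) θ)).hasFDerivAt.comp θ hsnd).clm_apply
    ((hg2 (α x, θ)).hasFDerivAt.partial_snd.clm_apply (hasFDerivAt_const ((u, 0) : E₁ × H) θ))
  have hsymmω : IsSymmSndFDerivAt ℝ ω (f (α x) θ) :=
    hω.contDiffAt.isSymmSndFDerivAt (by simp)
  rw [← ContinuousLinearMap.adjoint_comp, ← ContinuousLinearMap.adjoint_comp, ← map_add, hDF,
    (hfst θ).fderiv, hsnd.fderiv]
  congr 1
  refine hderiv.fderiv.trans ?_
  ext U
  have hU : fderiv ℝ (fun x' => fderiv ℝ (f x') θ) (α x) u U =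
      fderiv ℝ (fderiv ℝ g) (α x, θ) (0, U) (u, 0) := (hmixed U).trans (hsymm _ _)
  simp [hU, hsymmω.eq (fderiv ℝ g (α x, θ) (0, U)), add_comm]
end

section
/- Let σ : ℝ → ℝ be twice continuously differentiable, let f(x; W, b) = S(Wx + b) with z = Wx + b, and let g : ℝ^m → ℝ^p be twice continuously differentiable. Then for all v₁ ∈ ℝ^n and v₂ ∈ ℝ^p, (v₁ ⌟ D²(g ∘ f)(x))*·v₂ = Wᵀ·( S'(z) ⊙ [ ((S'(z) ⊙ (Wv₁)) ⌟ D²g(S(z)))*·v₂ ] ) + Wᵀ·( S''(z) ⊙ (Wv₁) ⊙ (D*g(S(z))·v₂) ). -/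
/-- Matrix-vector product `W · x`, with `m × n` matrices encoded as
`EuclideanSpace ℝ (Fin m × Fin n)`. -/
noncomputable def mulVecE {m n : ℕ} (W : EuclideanSpace ℝ (Fin m × Fin n))
    (x : EuclideanSpace ℝ (Fin n)) : EuclideanSpace ℝ (Fin m) :=
  (WithLp.equiv 2 _).symm fun i => ∑ j, W (i, j) * x j

/-- Transposed matrix-vector product `Wᵀ · u`. -/
noncomputable def tmulVecE {m n : ℕ} (W : EuclideanSpace ℝ (Fin m × Fin n))
    (u : EuclideanSpace ℝ (Fin m)) : EuclideanSpace ℝ (Fin n) :=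
  (WithLp.equiv 2 _).symm fun j => ∑ i, W (i, j) * u i

/-- Componentwise (Hadamard) product. -/
noncomputable def had {ι : Type*} [Fintype ι] (a b : EuclideanSpace ℝ ι) :
    EuclideanSpace ℝ ι :=
  (WithLp.equiv 2 _).symm fun i => a i * b i

/-- `mulVecE W` as a continuous linear map. -/
noncomputable def mulVecCLM {m n : ℕ} (W : EuclideanSpace ℝ (Fin m × Fin n)) :
    EuclideanSpace ℝ (Fin n) →L[ℝ] EuclideanSpace ℝ (Fin m) :=
  LinearMap.toContinuousLinearMap
    { toFun := mulVecE W
      map_add' := fun x y => by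
        ext i
        simp [mulVecE, mul_add, Finset.sum_add_distrib]
      map_smul' := fun c x => by
        ext i
        simp [mulVecE, Finset.mul_sum, mul_left_comm] }

@[simp]
theorem mulVecCLM_apply {m n : ℕ} (W : EuclideanSpace ℝ (Fin m × Fin n))
    (x : EuclideanSpace ℝ (Fin n)) : mulVecCLM W x = mulVecE W x := rfl

/-- `had a` as a continuous linear map. -/
noncomputable def hadCLM {ι : Type*} [Fintype ι] (a : EuclideanSpace ℝ ι) :
    EuclideanSpace ℝ ι →L[ℝ] EuclideanSpace ℝ ι :=
  LinearMap.toContinuousLinearMap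
    { toFun := had a
      map_add' := fun x y => by
        ext i
        simp [had, mul_add]
      map_smul' := fun c x => by
        ext i
        simp [had, mul_left_comm] }

@[simp]
theorem hadCLM_apply {ι : Type*} [Fintype ι] (a b : EuclideanSpace ℝ ι) :
    hadCLM a b = had a b := rfl

theorem had_comm {ι : Type*} [Fintype ι] (a b : EuclideanSpace ℝ ι) : had a b = had b a := by
  ext i
  simp [had, mul_comm]

theorem inner_had_right {ι : Type*} [Fintype ι] (a b c : EuclideanSpace ℝ ι) :
    inner ℝ a (had b c) = inner ℝ (had b a) c := by
  simp only [had, PiLp.inner_apply, WithLp.equiv_symm_apply, RCLike.inner_apply, conj_trivial]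
  exact Finset.sum_congr rfl fun i _ => by ring

theorem inner_tmulVecE_right {m n : ℕ} (W : EuclideanSpace ℝ (Fin m × Fin n))
    (w : EuclideanSpace ℝ (Fin n)) (u : EuclideanSpace ℝ (Fin m)) :
    inner ℝ w (tmulVecE W u) = inner ℝ (mulVecE W w) u := by
  simp only [tmulVecE, mulVecE, PiLp.inner_apply, WithLp.equiv_symm_apply, RCLike.inner_apply,
    conj_trivial, Finset.sum_mul, Finset.mul_sum]
  rw [Finset.sum_comm]
  exact Finset.sum_congr rfl fun i _ => Finset.sum_congr rfl fun j _ => by ring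

/-- The derivative of an elementwise map is the Hadamard product with the elementwise
derivative. -/
theorem hasFDerivAt_of_elementwise {ι : Type*} [Fintype ι] {σ : ℝ → ℝ}
    (hσ : Differentiable ℝ σ) {S S' : EuclideanSpace ℝ ι → EuclideanSpace ℝ ι}
    (hS : ∀ v k, S v k = σ (v k)) (hS' : ∀ v k, S' v k = deriv σ (v k))
    (v : EuclideanSpace ℝ ι) : HasFDerivAt S (hadCLM (S' v)) v := by
  rw [← hasFDerivWithinAt_univ, hasFDerivWithinAt_euclidean]
  intro k
  have h := (hσ (v k)).hasDerivAt.comp_hasFDerivAt v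
    (EuclideanSpace.proj k : EuclideanSpace ℝ ι →L[ℝ] ℝ).hasFDerivAt
  rw [hasFDerivWithinAt_univ]
  refine (h.congr_fderiv ?_).congr_of_eventuallyEq (.of_forall fun y => hS y k)
  ext w
  simp [had, hS']

theorem contDiff_of_elementwise {ι : Type*} [Fintype ι] {σ : ℝ → ℝ} {r : WithTop ℕ∞}
    (hσ : ContDiff ℝ r σ) {S : EuclideanSpace ℝ ι → EuclideanSpace ℝ ι}
    (hS : ∀ v k, S v k = σ (v k)) : ContDiff ℝ r S := by
  rw [contDiff_euclidean]
  intro k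
  simp only [hS]
  exact hσ.comp (EuclideanSpace.proj k : EuclideanSpace ℝ ι →L[ℝ] ℝ).contDiff

/-- Let `σ : ℝ → ℝ` and `g : ℝ^m → ℝ^p` be twice continuously
differentiable and `f(x; W, b) = S (W x + b)` with `z = W x + b`.  Then for all `v₁ : ℝ^n` and
`v₂ : ℝ^p`,
`(v₁ ⌟ D²(g ∘ f)(x))*·v₂ = Wᵀ·(S'(z) ⊙ [((S'(z) ⊙ (W v₁)) ⌟ D²g(S z))*·v₂])
  + Wᵀ·(S''(z) ⊙ (W v₁) ⊙ (D*g(S z)·v₂))`. -/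
theorem statement17 {n m p : ℕ} (σ : ℝ → ℝ) (hσ : ContDiff ℝ 2 σ)
    (S S' S'' : EuclideanSpace ℝ (Fin m) → EuclideanSpace ℝ (Fin m))
    (hS : ∀ v k, S v k = σ (v k)) (hS' : ∀ v k, S' v k = deriv σ (v k))
    (hS'' : ∀ v k, S'' v k = deriv (deriv σ) (v k))
    (x : EuclideanSpace ℝ (Fin n)) (W : EuclideanSpace ℝ (Fin m × Fin n))
    (b : EuclideanSpace ℝ (Fin m))
    (f : EuclideanSpace ℝ (Fin n) → EuclideanSpace ℝ (Fin m))
    (hf : ∀ x', f x' = S (mulVecE W x' + b))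
    (z : EuclideanSpace ℝ (Fin m)) (hz : z = mulVecE W x + b)
    (g : EuclideanSpace ℝ (Fin m) → EuclideanSpace ℝ (Fin p))
    (hg : ContDiff ℝ 2 g) :
    ∀ (v₁ : EuclideanSpace ℝ (Fin n)) (v₂ : EuclideanSpace ℝ (Fin p)),
      ContinuousLinearMap.adjoint (fderiv ℝ (fderiv ℝ (g ∘ f)) x v₁) v₂ =
        tmulVecE W (had (S' z)
            (ContinuousLinearMap.adjoint
              (fderiv ℝ (fderiv ℝ g) (S z) (had (S' z) (mulVecE W v₁))) v₂)) +
          tmulVecE W (had (had (S'' z) (mulVecE W v₁))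
            (ContinuousLinearMap.adjoint (fderiv ℝ g (S z)) v₂)) := by
  intro v₁ v₂
  have hσ' : ContDiff ℝ 1 (deriv σ) := by
    have h : ContDiff ℝ (1 + 1) σ := by simpa [one_add_one_eq_two] using hσ
    exact (contDiff_succ_iff_deriv.1 h).2.2
  have hA : ∀ y, HasFDerivAt (fun y => mulVecE W y + b) (mulVecCLM W) y := fun y =>
    (mulVecCLM W).hasFDerivAt.add_const b
  have hAc : ContDiff ℝ 2 (fun y => mulVecE W y + b) :=
    (mulVecCLM W).contDiff.add contDiff_const
  obtain rfl : f = fun y => S (mulVecE W y + b) := funext hf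
  subst hz
  have hfc : ContDiff ℝ 2 (fun y => S (mulVecE W y + b)) :=
    (contDiff_of_elementwise hσ hS).comp hAc
  have hfd : ∀ y, HasFDerivAt (fun y => S (mulVecE W y + b))
      ((hadCLM (S' (mulVecE W y + b))).comp (mulVecCLM W)) y := fun y =>
    (hasFDerivAt_of_elementwise (hσ.differentiable two_ne_zero) hS hS' _).comp y (hA y)
  have hS'd : ∀ y, HasFDerivAt (fun y => S' (mulVecE W y + b))
      ((hadCLM (S'' (mulVecE W y + b))).comp (mulVecCLM W)) y := fun y =>
    (hasFDerivAt_of_elementwise (hσ'.differentiable one_ne_zero) hS' hS'' _).comp y (hA y)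
  have hgd : Differentiable ℝ g := hg.differentiable two_ne_zero
  have hg' : Differentiable ℝ (fderiv ℝ g) :=
    (hg.fderiv_right (m := 1) (by norm_num)).differentiable one_ne_zero
  have hgf' : Differentiable ℝ (fderiv ℝ (g ∘ fun y => S (mulVecE W y + b))) :=
    ((hg.comp hfc).fderiv_right (m := 1) (by norm_num)).differentiable one_ne_zero
  have key : ∀ w, fderiv ℝ (fderiv ℝ (g ∘ fun y => S (mulVecE W y + b))) x v₁ w =
      fderiv ℝ (fderiv ℝ g) (S (mulVecE W x + b))
          (had (S' (mulVecE W x + b)) (mulVecE W v₁)) (had (S' (mulVecE W x + b)) (mulVecE W w)) +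
        fderiv ℝ g (S (mulVecE W x + b))
          (had (had (S'' (mulVecE W x + b)) (mulVecE W v₁)) (mulVecE W w)) := by
    intro w
    have h₁ : HasFDerivAt
        (fun y => fderiv ℝ (g ∘ fun y => S (mulVecE W y + b)) y w) _ x :=
      (hgf' x).hasFDerivAt.clm_apply (hasFDerivAt_const w x)
    have h₂ : HasFDerivAt (fun y => fderiv ℝ g (S (mulVecE W y + b))
        (hadCLM (mulVecE W w) (S' (mulVecE W y + b)))) _ x :=
      ((hg' _).hasFDerivAt.comp x (hfd x)).clm_apply
        ((hadCLM (mulVecE W w)).hasFDerivAt.comp x (hS'd x))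
    have h₃ : (fun y => fderiv ℝ (g ∘ fun y => S (mulVecE W y + b)) y w) =
        fun y => fderiv ℝ g (S (mulVecE W y + b))
          (hadCLM (mulVecE W w) (S' (mulVecE W y + b))) := by
      funext y
      rw [((hgd _).hasFDerivAt.comp y (hfd y)).fderiv]
      simp [had_comm (mulVecE W w)]
    rw [h₃] at h₁
    have h := DFunLike.congr_fun (h₁.unique h₂) v₁
    simp only [had_comm (mulVecE W w), add_apply,
      ContinuousLinearMap.comp_apply, ContinuousLinearMap.flip_apply, hadCLM_apply,
      mulVecCLM_apply, zero_apply, map_zero, zero_add] at h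
    rw [h, add_comm, Function.comp_apply]
  refine ext_inner_left ℝ fun w => ?_
  rw [inner_add_right, inner_tmulVecE_right, inner_tmulVecE_right, inner_had_right,
    inner_had_right, ContinuousLinearMap.adjoint_inner_right,
    ContinuousLinearMap.adjoint_inner_right, ContinuousLinearMap.adjoint_inner_right, key,
    inner_add_left]
end
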